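/- Fix α1, α2 ≥ 0 with α1 + α2 = 1 and set C0 = log2(1 + P̄β0/H²). Consider the rate-profile problem without the speed constraint: maximize r over all measurable trajectories x : [0,T] → ℝ, feasible power allocations (p1, p2), and pairs (r1, r2) achievable for (x, p1, p2) with r1 ≥ α1·r and r2 ≥ α2·r. The optimal value equals C0, and it is attained by the trajectory and power allocation x(t) = -D/2, p1(t) = P̄, p2(t) = 0 for t ∈ [0, α1·T) and x(t) = D/2, p1(t) = 0, p2(t) = P̄ for t ∈ [α1·T, T], for which the rate pair (α1·C0, α2·C0) is achievable. -/

import Mathlib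

open MeasureTheory

/-- Channel power gain (normalized by noise) from the UAV at horizontal position `x`
to ground user 1 located at `-D/2`. -/
noncomputable def h1 (D H β0 x : ℝ) : ℝ := β0 / ((x + D / 2) ^ 2 + H ^ 2)

/-- Channel power gain from the UAV at horizontal position `x` to ground user 2
located at `D/2`. -/
noncomputable def h2 (D H β0 x : ℝ) : ℝ := β0 / ((x - D / 2) ^ 2 + H ^ 2)

/-- A feasible power allocation: measurable, nonnegative, total power at most `P`. -/
def FeasiblePower (P T : ℝ) (p1 p2 : ℝ → ℝ) : Prop :=
  Measurable p1 ∧ Measurable p2 ∧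
    ∀ t ∈ Set.Icc (0 : ℝ) T, 0 ≤ p1 t ∧ 0 ≤ p2 t ∧ p1 t + p2 t ≤ P

/-- The rate pair `(r1, r2)` is achievable for trajectory `x` and power allocation
`(p1, p2)`. -/
def Achievable (D H β0 T : ℝ) (x p1 p2 : ℝ → ℝ) (r1 r2 : ℝ) : Prop :=
  0 ≤ r1 ∧ 0 ≤ r2 ∧
    r1 ≤ (1 / T) * ∫ t in (0 : ℝ)..T, Real.logb 2 (1 + p1 t * h1 D H β0 (x t)) ∧
    r2 ≤ (1 / T) * ∫ t in (0 : ℝ)..T, Real.logb 2 (1 + p2 t * h2 D H β0 (x t)) ∧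
    r1 + r2 ≤ (1 / T) * ∫ t in (0 : ℝ)..T,
      Real.logb 2 (1 + p1 t * h1 D H β0 (x t) + p2 t * h2 D H β0 (x t))

theorem integral_ite_lt_const {a T : ℝ} (c d : ℝ) (ha : 0 ≤ a) (haT : a ≤ T) :
    ∫ t in (0 : ℝ)..T, (if t < a then c else d) = a * c + (T - a) * d := by
  have hl : ∀ t ∈ Set.uIoo 0 a, (if t < a then c else d) = c := fun t ht => by
    rw [Set.uIoo_of_le ha] at ht
    exact if_pos ht.2
  have hr : ∀ t ∈ Set.uIoo a T, (if t < a then c else d) = d := fun t ht => by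
    rw [Set.uIoo_of_le haT] at ht
    exact if_neg ht.1.le.not_gt
  rw [← intervalIntegral.integral_add_adjacent_intervals (b := a)
      (intervalIntegrable_const.congr_uIoo fun t ht => (hl t ht).symm)
      (intervalIntegrable_const.congr_uIoo fun t ht => (hr t ht).symm),
    intervalIntegral.integral_congr_uIoo hl, intervalIntegral.integral_congr_uIoo hr]
  simp

theorem h1_nonneg {β0 : ℝ} (D H x : ℝ) (hβ : 0 ≤ β0) : 0 ≤ h1 D H β0 x := by
  unfold h1; positivity

theorem h2_nonneg {β0 : ℝ} (D H x : ℝ) (hβ : 0 ≤ β0) : 0 ≤ h2 D H β0 x := by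
  unfold h2; positivity

theorem h1_le {H β0 : ℝ} (D x : ℝ) (hH : 0 < H) (hβ : 0 ≤ β0) :
    h1 D H β0 x ≤ β0 / H ^ 2 :=
  div_le_div_of_nonneg_left hβ (by positivity) (le_add_of_nonneg_left (sq_nonneg _))

theorem h2_le {H β0 : ℝ} (D x : ℝ) (hH : 0 < H) (hβ : 0 ≤ β0) :
    h2 D H β0 x ≤ β0 / H ^ 2 :=
  div_le_div_of_nonneg_left hβ (by positivity) (le_add_of_nonneg_left (sq_nonneg _))

theorem h1_neg_half (D H β0 : ℝ) : h1 D H β0 (-(D / 2)) = β0 / H ^ 2 := by simp [h1]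

theorem h2_half (D H β0 : ℝ) : h2 D H β0 (D / 2) = β0 / H ^ 2 := by simp [h2]

theorem norm_logb_sum_rate_le {D H β0 P : ℝ} (hH : 0 < H) (hβ : 0 ≤ β0) {p1 p2 : ℝ}
    (hp1 : 0 ≤ p1) (hp2 : 0 ≤ p2) (hp : p1 + p2 ≤ P) (x : ℝ) :
    ‖Real.logb 2 (1 + p1 * h1 D H β0 x + p2 * h2 D H β0 x)‖
      ≤ Real.logb 2 (1 + P * β0 / H ^ 2) := by
  have n1 : 0 ≤ p1 * h1 D H β0 x := mul_nonneg hp1 (h1_nonneg D H x hβ)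
  have n2 : 0 ≤ p2 * h2 D H β0 x := mul_nonneg hp2 (h2_nonneg D H x hβ)
  rw [Real.norm_of_nonneg (Real.logb_nonneg one_lt_two (by linarith))]
  refine Real.logb_le_logb_of_le one_lt_two (by linarith) ?_
  calc 1 + p1 * h1 D H β0 x + p2 * h2 D H β0 x
      ≤ 1 + p1 * (β0 / H ^ 2) + p2 * (β0 / H ^ 2) := by
        gcongr
        · exact h1_le D x hH hβ
        · exact h2_le D x hH hβ
    _ = 1 + (p1 + p2) * (β0 / H ^ 2) := by ring
    _ ≤ 1 + P * (β0 / H ^ 2) := by gcongr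
    _ = 1 + P * β0 / H ^ 2 := by ring

theorem add_rate_le_of_achievable {D H β0 P T : ℝ} (hH : 0 < H) (hβ : 0 ≤ β0) (hT : 0 < T)
    {x p1 p2 : ℝ → ℝ} (hp : FeasiblePower P T p1 p2) {r1 r2 : ℝ}
    (h : Achievable D H β0 T x p1 p2 r1 r2) :
    r1 + r2 ≤ Real.logb 2 (1 + P * β0 / H ^ 2) := by
  obtain ⟨-, -, hp⟩ := hp
  have hint := intervalIntegral.norm_integral_le_of_norm_le_const (a := 0) (b := T)
    (f := fun t => Real.logb 2 (1 + p1 t * h1 D H β0 (x t) + p2 t * h2 D H β0 (x t)))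
    (C := Real.logb 2 (1 + P * β0 / H ^ 2)) fun t ht => by
      rw [Set.uIoc_of_le hT.le] at ht
      obtain ⟨hp1, hp2, hsum⟩ := hp t ⟨ht.1.le, ht.2⟩
      exact norm_logb_sum_rate_le hH hβ hp1 hp2 hsum (x t)
  rw [sub_zero, abs_of_pos hT] at hint
  refine h.2.2.2.2.trans ?_
  rw [one_div, inv_mul_le_iff₀ hT, mul_comm T]
  exact (Real.le_norm_self _).trans hint

theorem feasiblePower_switch {P : ℝ} (hP : 0 ≤ P) (T a : ℝ) :
    FeasiblePower P T (fun t => if t < a then P else 0) (fun t => if t < a then 0 else P) := by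
  refine ⟨Measurable.ite measurableSet_Iio measurable_const measurable_const,
    Measurable.ite measurableSet_Iio measurable_const measurable_const, fun t _ => ?_⟩
  dsimp only
  split_ifs <;> simp [hP]

theorem achievable_hover_switch (D H : ℝ) {β0 P T α1 α2 : ℝ} (hβ : 0 ≤ β0) (hP : 0 ≤ P)
    (hT : 0 < T) (hα1 : 0 ≤ α1) (hα2 : 0 ≤ α2) (hα : α1 + α2 = 1) :
    Achievable D H β0 T (fun t : ℝ => if t < α1 * T then -(D / 2) else D / 2)
      (fun t => if t < α1 * T then P else 0) (fun t => if t < α1 * T then 0 else P)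
      (α1 * Real.logb 2 (1 + P * β0 / H ^ 2)) (α2 * Real.logb 2 (1 + P * β0 / H ^ 2)) := by
  have hC : 0 ≤ Real.logb 2 (1 + P * β0 / H ^ 2) :=
    Real.logb_nonneg one_lt_two (le_add_of_nonneg_right (by positivity))
  have ha : 0 ≤ α1 * T := by positivity
  have haT : α1 * T ≤ T := mul_le_of_le_one_left hT.le (by linarith)
  obtain rfl : α2 = 1 - α1 := by linarith
  refine ⟨by positivity, by positivity, ?_, ?_, ?_⟩
  · have e : ∀ t : ℝ, Real.logb 2 (1 + (if t < α1 * T then P else 0) *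
        h1 D H β0 (if t < α1 * T then -(D / 2) else D / 2)) =
        if t < α1 * T then Real.logb 2 (1 + P * β0 / H ^ 2) else 0 := fun t => by
      split_ifs <;> simp [h1_neg_half, mul_div_assoc]
    simp only [e, integral_ite_lt_const _ _ ha haT]
    exact le_of_eq (by field_simp; ring)
  · have e : ∀ t : ℝ, Real.logb 2 (1 + (if t < α1 * T then 0 else P) *
        h2 D H β0 (if t < α1 * T then -(D / 2) else D / 2)) =
        if t < α1 * T then 0 else Real.logb 2 (1 + P * β0 / H ^ 2) := fun t => by
      split_ifs <;> simp [h2_half, mul_div_assoc]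
    simp only [e, integral_ite_lt_const _ _ ha haT]
    exact le_of_eq (by field_simp; ring)
  · have e : ∀ t : ℝ, Real.logb 2 (1 + (if t < α1 * T then P else 0) *
        h1 D H β0 (if t < α1 * T then -(D / 2) else D / 2) + (if t < α1 * T then 0 else P) *
        h2 D H β0 (if t < α1 * T then -(D / 2) else D / 2)) =
        Real.logb 2 (1 + P * β0 / H ^ 2) := fun t => by
      split_ifs <;> simp [h1_neg_half, h2_half, mul_div_assoc]
    simp only [e, intervalIntegral.integral_const, smul_eq_mul]
    exact le_of_eq (by field_simp; ring)

/-- Without the speed constraint, the optimal value of the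
rate-profile problem with weights `(α1, α2)` equals `C0 = log2(1 + P β0 / H²)`,
and it is attained by hovering at `-D/2` serving user 1 with full power during
`[0, α1 T)` and hovering at `D/2` serving user 2 with full power during `[α1 T, T]`. -/
theorem rate_profile_no_speed_constraint (D H β0 P T α1 α2 : ℝ)
    (hD : 0 < D) (hH : 0 < H) (hβ : 0 < β0) (hP : 0 < P) (hT : 0 < T)
    (hα1 : 0 ≤ α1) (hα2 : 0 ≤ α2) (hα : α1 + α2 = 1) :
    IsGreatest {r : ℝ | ∃ x p1 p2, Measurable x ∧ FeasiblePower P T p1 p2 ∧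
        ∃ r1 r2, Achievable D H β0 T x p1 p2 r1 r2 ∧ α1 * r ≤ r1 ∧ α2 * r ≤ r2}
      (Real.logb 2 (1 + P * β0 / H ^ 2)) ∧
    (Measurable (fun t : ℝ => if t < α1 * T then -(D / 2) else D / 2) ∧
     FeasiblePower P T (fun t => if t < α1 * T then P else 0)
       (fun t => if t < α1 * T then 0 else P) ∧
     Achievable D H β0 T (fun t : ℝ => if t < α1 * T then -(D / 2) else D / 2)
       (fun t => if t < α1 * T then P else 0) (fun t => if t < α1 * T then 0 else P)
       (α1 * Real.logb 2 (1 + P * β0 / H ^ 2))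
       (α2 * Real.logb 2 (1 + P * β0 / H ^ 2))) := by
  have hx : Measurable (fun t : ℝ => if t < α1 * T then -(D / 2) else D / 2) :=
    Measurable.ite measurableSet_Iio measurable_const measurable_const
  have hp := feasiblePower_switch hP.le T (α1 * T)
  have hach := achievable_hover_switch D H hβ.le hP.le hT hα1 hα2 hα
  refine ⟨⟨⟨_, _, _, hx, hp, _, _, hach, le_rfl, le_rfl⟩, ?_⟩, hx, hp, hach⟩
  rintro r ⟨x, p1, p2, -, hfeas, r1, r2, hr, hr1, hr2⟩
  calc r = α1 * r + α2 * r := by rw [← add_mul, hα, one_mul]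
    _ ≤ r1 + r2 := add_le_add hr1 hr2
    _ ≤ _ := add_rate_le_of_achievable hH hβ.le hT hfeas hr
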